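/- Let K be any field and n ≥ 2 an integer. Then the Leavitt algebra L_K(n) is infinite dimensional as a K-vector space. -/

import Mathlib

noncomputable section

open scoped BigOperators

/-- The defining relations of the Cohn algebra `C_K(n)`: `y_i x_j = δ_{ij} 1`.
Generators of the free algebra: `Sum.inl i` is `x_i`, `Sum.inr i` is `y_i`.
Quotienting by this relation is the same as quotienting by the two-sided ideal
generated by the elements `y_i x_j - δ_{ij} 1`. -/
inductive CohnRel (K : Type) [Field K] (n : ℕ) :
    FreeAlgebra K (Fin n ⊕ Fin n) → FreeAlgebra K (Fin n ⊕ Fin n) → Prop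
  | rel (i j : Fin n) : CohnRel K n
      (FreeAlgebra.ι K (Sum.inr i) * FreeAlgebra.ι K (Sum.inl j))
      (if i = j then 1 else 0)

/-- The Cohn algebra `C_K(n)`. -/
abbrev CohnAlgebra (K : Type) [Field K] (n : ℕ) := RingQuot (CohnRel K n)

/-- The generator `x_i` of the Cohn algebra. -/
def cX (K : Type) [Field K] (n : ℕ) (i : Fin n) : CohnAlgebra K n :=
  RingQuot.mkAlgHom K (CohnRel K n) (FreeAlgebra.ι K (Sum.inl i))

/-- The generator `y_i` of the Cohn algebra. -/
def cY (K : Type) [Field K] (n : ℕ) (i : Fin n) : CohnAlgebra K n :=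
  RingQuot.mkAlgHom K (CohnRel K n) (FreeAlgebra.ι K (Sum.inr i))

/-- `x_I` for a word `I` in the alphabet `{1, …, n}` (words are lists, the empty
list being the empty word, with `x_φ = 1`). -/
def xw (K : Type) [Field K] (n : ℕ) (I : List (Fin n)) : CohnAlgebra K n :=
  (I.map (cX K n)).prod

/-- `y_I` for a word `I`. -/
def yw (K : Type) [Field K] (n : ℕ) (I : List (Fin n)) : CohnAlgebra K n :=
  (I.map (cY K n)).prod

/-- The Leavitt relation `∑ x_i y_i = 1`; quotienting `C_K(n)` by this relation is
the same as quotienting by the two-sided ideal `M` generated by `1 - ∑ x_i y_i`. -/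
inductive LeavittRel (K : Type) [Field K] (n : ℕ) :
    CohnAlgebra K n → CohnAlgebra K n → Prop
  | rel : LeavittRel K n (∑ i : Fin n, cX K n i * cY K n i) 1

/-- The Leavitt algebra `L_K(n) = C_K(n)/M`. -/
abbrev LeavittAlgebra (K : Type) [Field K] (n : ℕ) := RingQuot (LeavittRel K n)

/-- The canonical quotient map `C_K(n) → L_K(n)`, `z ↦ z̄`. -/
def leavittQuot (K : Type) [Field K] (n : ℕ) : CohnAlgebra K n →ₐ[K] LeavittAlgebra K n :=
  RingQuot.mkAlgHom K (LeavittRel K n)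

def opX (K : Type) [Field K] (n : ℕ) [NeZero n] (i : Fin n) : Module.End K (ℕ → K) where
  toFun f k := if (Nat.divModEquiv n k).2 = i then f (Nat.divModEquiv n k).1 else 0
  map_add' f g := by ext k; simp only [Pi.add_apply]; split_ifs <;> simp
  map_smul' c f := by ext k; simp

def opY (K : Type) [Field K] (n : ℕ) [NeZero n] (i : Fin n) : Module.End K (ℕ → K) where
  toFun f m := f ((Nat.divModEquiv n).symm (m, i))
  map_add' f g := rfl
  map_smul' c f := rfl

theorem opYX (K : Type) [Field K] (n : ℕ) [NeZero n] (i j : Fin n) :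
    opY K n i * opX K n j = if i = j then 1 else 0 := by
  apply LinearMap.ext
  intro f
  funext m
  have h : (opY K n i * opX K n j) f m = if i = j then f m else 0 := by
    change (if (Nat.divModEquiv n ((Nat.divModEquiv n).symm (m, i))).2 = j then
      f (Nat.divModEquiv n ((Nat.divModEquiv n).symm (m, i))).1 else 0) = _
    rw [Equiv.apply_symm_apply]
  rw [h]
  split_ifs <;> rfl

theorem opXY (K : Type) [Field K] (n : ℕ) [NeZero n] :
    ∑ i, opX K n i * opY K n i = 1 := by
  apply LinearMap.ext
  intro f
  funext k
  rw [LinearMap.sum_apply, Finset.sum_apply]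
  have h : ∀ i, (opX K n i * opY K n i) f k =
      if (Nat.divModEquiv n k).2 = i then
        f ((Nat.divModEquiv n).symm ((Nat.divModEquiv n k).1, i)) else 0 := fun i => rfl
  simp only [h, Finset.sum_ite_eq, Finset.mem_univ, if_true]
  rw [Prod.mk.eta, Equiv.symm_apply_apply]
  rfl

def cohnRep (K : Type) [Field K] (n : ℕ) [NeZero n] :
    CohnAlgebra K n →ₐ[K] Module.End K (ℕ → K) :=
  RingQuot.liftAlgHom K ⟨FreeAlgebra.lift K (Sum.elim (opX K n) (opY K n)), by
    rintro _ _ ⟨i, j⟩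
    rw [map_mul, FreeAlgebra.lift_ι_apply, FreeAlgebra.lift_ι_apply, Sum.elim_inl,
      Sum.elim_inr, opYX]
    split_ifs <;> simp⟩

theorem leavitt_nontrivial (K : Type) [Field K] (n : ℕ) [NeZero n] :
    Nontrivial (LeavittAlgebra K n) := by
  let φ : LeavittAlgebra K n →ₐ[K] Module.End K (ℕ → K) :=
    RingQuot.liftAlgHom K ⟨cohnRep K n, by
      rintro _ _ ⟨⟩
      rw [map_sum, map_one, ← opXY K n]
      refine Finset.sum_congr rfl fun i _ => ?_
      rw [map_mul]
      simp [cX, cY, cohnRep]⟩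
  exact φ.toRingHom.domain_nontrivial

theorem cohn_yx (K : Type) [Field K] (n : ℕ) (i j : Fin n) :
    cY K n i * cX K n j = if i = j then 1 else 0 := by
  have h := RingQuot.mkAlgHom_rel K (CohnRel.rel (K := K) i j)
  rw [map_mul] at h
  rw [cX, cY, h]
  split_ifs <;> simp

/-- Lemma 3.1(ii): `L_K(n)` is infinite dimensional over `K`. -/
theorem leavitt_infinite_dimensional (K : Type) [Field K] (n : ℕ) (hn : 2 ≤ n) :
    ¬ Module.Finite K (LeavittAlgebra K n) := by
  intro hfin
  haveI : NeZero n := ⟨by omega⟩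
  haveI := leavitt_nontrivial K n
  let q := leavittQuot K n
  have h : ∀ i j, q (cY K n i) * q (cX K n j) = if i = j then 1 else 0 := by
    intro i j
    rw [← map_mul, cohn_yx]
    split_ifs <;> simp
  let a : Fin n := ⟨0, by omega⟩
  let b : Fin n := ⟨1, by omega⟩
  have hba : b ≠ a := by simp [a, b]
  have haa : q (cY K n a) * q (cX K n a) = 1 := by rw [h, if_pos rfl]
  have hinj : Function.Injective (LinearMap.mulLeft K (q (cX K n a))) := by
    intro u v huv
    simp only [LinearMap.mulLeft_apply] at huv
    have := congrArg (fun z => q (cY K n a) * z) huv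
    simpa only [← mul_assoc, haa, one_mul] using this
  have hs : Function.Surjective (LinearMap.mulLeft K (q (cX K n a))) :=
    LinearMap.surjective_of_injective (K := K) (V := LeavittAlgebra K n) hinj
  obtain ⟨z, hz⟩ := hs 1
  rw [LinearMap.mulLeft_apply] at hz
  have h0 : q (cY K n b) = 0 := by
    rw [← mul_one (q (cY K n b)), ← hz, ← mul_assoc, h, if_neg hba, zero_mul]
  have h1 := h b b
  rw [h0, zero_mul, if_pos rfl] at h1
  exact zero_ne_one h1
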